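/- Let g ≥ 2 and let d be a positive integer. Let U, U' ⊆ ℤ^{2g} be two complete (saturated) rank-two submodules such that U has a basis (x, y) with ω(x, y) = d and U' has a basis (x', y') with ω(x', y') = d. Then there exists a matrix M ∈ Sp(2g,ℤ) with M·U = U'. In other words, Sp(2g,ℤ) acts transitively on complete rank-two symplectic sublattices of ℤ^{2g} with determinant d. -/

import Mathlib

open scoped BigOperators

/-- The standard symplectic form
`ω(x,y) = Σ_{i=0}^{g-1} (x_{2i}·y_{2i+1} − x_{2i+1}·y_{2i})` on `R^{2g}`. -/
def stdSymp {R : Type*} [CommRing R] (g : ℕ) (x y : Fin (2 * g) → R) : R :=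
  ∑ i : Fin g,
    (x ⟨2 * i.val, by have := i.isLt; omega⟩ * y ⟨2 * i.val + 1, by have := i.isLt; omega⟩
      - x ⟨2 * i.val + 1, by have := i.isLt; omega⟩ * y ⟨2 * i.val, by have := i.isLt; omega⟩)

section Aux

/-- Unimodularity: every linear functional is represented. -/
def SpAux.Uni {M : Type} [AddCommGroup M] (B : M →ₗ[ℤ] M →ₗ[ℤ] ℤ) : Prop :=
  ∀ φ : M →ₗ[ℤ] ℤ, ∃ v, ∀ w, B v w = φ w

/-- The orthogonal complement of a pair. -/
def SpAux.perp {M : Type} [AddCommGroup M] (B : M →ₗ[ℤ] M →ₗ[ℤ] ℤ) (e f : M) :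
    Submodule ℤ M := LinearMap.ker (B e) ⊓ LinearMap.ker (B f)

/-- The restricted form. -/
def SpAux.res {M : Type} [AddCommGroup M] (B : M →ₗ[ℤ] M →ₗ[ℤ] ℤ) (W : Submodule ℤ M) :
    W →ₗ[ℤ] W →ₗ[ℤ] ℤ := B.domRestrict₁₂ W W

namespace SpAux

variable {M : Type} [AddCommGroup M] {B : M →ₗ[ℤ] M →ₗ[ℤ] ℤ}

lemma res_apply (W : Submodule ℤ M) (u v : W) : res B W u v = B u v := rfl

lemma mem_perp {e f w : M} : w ∈ perp B e f ↔ B e w = 0 ∧ B f w = 0 := by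
  simp [perp]

lemma skew (ha : ∀ x, B x x = 0) (x y : M) : B x y = - B y x := by
  have h := ha (x + y)
  simp only [map_add, LinearMap.add_apply, ha] at h
  linarith

lemma proj_mem (ha : ∀ x, B x x = 0) {e f : M} (h : B e f = 1) (v : M) :
    v - B v f • e - B e v • f ∈ perp B e f := by
  rw [mem_perp]
  have h1 := skew ha f e
  have h2 := skew ha v f
  simp [ha, h, h1, h2]

/-- Projection to the complement. -/
def proj (ha : ∀ x, B x x = 0) {e f : M} (h : B e f = 1) : M →ₗ[ℤ] perp B e f :=
  LinearMap.codRestrict _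
    (LinearMap.id - (B.flip f).smulRight e - (B e).smulRight f)
    (fun v => by simpa using proj_mem ha h v)

lemma proj_coe (ha : ∀ x, B x x = 0) {e f : M} (h : B e f = 1) (v : M) :
    (proj ha h v : M) = v - B v f • e - B e v • f := by
  simp [proj]

/-- The splitting. -/
def split (ha : ∀ x, B x x = 0) {e f : M} (h : B e f = 1) :
    M ≃ₗ[ℤ] (ℤ × ℤ) × perp B e f where
  toFun v := ((B v f, B e v), proj ha h v)
  map_add' u v := by simp
  map_smul' c v := by simp
  invFun p := p.1.1 • e + p.1.2 • f + p.2
  left_inv v := by simp [proj_coe]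
  right_inv p := by
    obtain ⟨⟨a, b⟩, w, hw⟩ := p
    have hw' := mem_perp.1 hw
    have h1 := skew ha w f
    refine Prod.ext (Prod.ext ?_ ?_) (Subtype.ext ?_)
    · simp [ha, h, hw', h1]
    · simp [ha, h, hw']
    · simp [proj_coe, ha, h, hw', h1]

lemma split_apply (ha : ∀ x, B x x = 0) {e f : M} (h : B e f = 1) (v : M) :
    split ha h v = ((B v f, B e v), proj ha h v) := rfl

lemma split_symm_apply (ha : ∀ x, B x x = 0) {e f : M} (h : B e f = 1)
    (p : (ℤ × ℤ) × perp B e f) :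
    (split ha h).symm p = p.1.1 • e + p.1.2 • f + p.2 := rfl

lemma finrank_perp [Module.Free ℤ M] [Module.Finite ℤ M]
    (ha : ∀ x, B x x = 0) {e f : M} (h : B e f = 1) :
    Module.finrank ℤ M = 2 + Module.finrank ℤ (perp B e f) := by
  rw [(split ha h).finrank_eq, Module.finrank_prod, Module.finrank_prod]
  simp

lemma uni_perp (ha : ∀ x, B x x = 0) (hu : Uni B) {e f : M} (h : B e f = 1) :
    Uni (res B (perp B e f)) := by
  intro φ
  obtain ⟨v, hv⟩ := hu (φ ∘ₗ proj ha h)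
  have h1 := skew ha f e
  have he : proj ha h e = 0 := by
    apply Subtype.ext; simp [proj_coe, ha, h]
  have hf : proj ha h f = 0 := by
    apply Subtype.ext; simp [proj_coe, ha, h]
  have hvm : v ∈ perp B e f := by
    rw [mem_perp, skew ha e v, skew ha f v, hv, hv]
    simp [he, hf]
  refine ⟨⟨v, hvm⟩, fun w => ?_⟩
  rw [res_apply]
  have hw := mem_perp.1 w.2
  have : proj ha h (w : M) = w := by
    apply Subtype.ext
    have := skew ha (w : M) f
    simp [proj_coe, hw, this]
  simp [hv, this]

lemma expand (ha : ∀ x, B x x = 0) {e f : M} (h : B e f = 1)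
    (p q : (ℤ × ℤ) × perp B e f) :
    B ((split ha h).symm p) ((split ha h).symm q)
      = p.1.1 * q.1.2 - p.1.2 * q.1.1 + res B _ p.2 q.2 := by
  have h1 := skew ha f e
  have hp := mem_perp.1 p.2.2
  have hq := mem_perp.1 q.2.2
  have h2 := skew ha (p.2 : M) e
  have h3 := skew ha (p.2 : M) f
  simp [split_symm_apply, res_apply, ha, h, h1, hp, hq, h2, h3]
  ring

/-- Extension of isometries across hyperbolic pairs. -/
lemma extend {M' : Type} [AddCommGroup M'] {B' : M' →ₗ[ℤ] M' →ₗ[ℤ] ℤ}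
    (ha : ∀ x, B x x = 0) (ha' : ∀ x, B' x x = 0)
    {e f : M} (h : B e f = 1) {e' f' : M'} (h' : B' e' f' = 1)
    (σ : perp B e f ≃ₗ[ℤ] perp B' e' f')
    (hσ : ∀ u v, res B' _ (σ u) (σ v) = res B _ u v) :
    ∃ τ : M ≃ₗ[ℤ] M', (∀ u v, B' (τ u) (τ v) = B u v) ∧ τ e = e' ∧ τ f = f' ∧
      ∀ w : perp B e f, τ w = σ w := by
  have key : ∀ p : (ℤ × ℤ) × perp B e f,
      ((split ha h).trans (((LinearEquiv.refl ℤ (ℤ × ℤ)).prodCongr σ).trans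
        (split ha' h').symm)) ((split ha h).symm p) = (split ha' h').symm (p.1, σ p.2) := by
    intro p
    simp
  refine ⟨(split ha h).trans (((LinearEquiv.refl ℤ (ℤ × ℤ)).prodCongr σ).trans
    (split ha' h').symm), ?_, ?_, ?_, ?_⟩
  · intro u v
    obtain ⟨p, rfl⟩ := (split ha h).symm.surjective u
    obtain ⟨q, rfl⟩ := (split ha h).symm.surjective v
    rw [key, key, expand, expand, hσ]
  · have := key ((1, 0), 0)
    simpa [split_symm_apply] using this
  · have := key ((0, 1), 0)
    simpa [split_symm_apply] using this
  · intro w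
    have := key ((0, 0), w)
    simpa [split_symm_apply] using this

lemma exists_hyp [Module.Free ℤ M] [Module.Finite ℤ M] (hu : Uni B)
    (hr : 0 < Module.finrank ℤ M) : ∃ e f, B e f = 1 := by
  let b := Module.finBasis ℤ M
  obtain ⟨v, hv⟩ := hu (b.coord ⟨0, hr⟩)
  exact ⟨v, b ⟨0, hr⟩, by simp [hv]⟩

lemma nondeg [Module.Free ℤ M] (ha : ∀ x, B x x = 0) (hu : Uni B) {v : M}
    (hv : ∀ w, B v w = 0) : v = 0 := by
  rw [← Module.forall_dual_apply_eq_zero_iff ℤ v]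
  intro φ
  obtain ⟨u, h⟩ := hu φ
  rw [← h, skew ha, hv, neg_zero]

lemma content [Module.Free ℤ M] [Module.Finite ℤ M] (ha : ∀ x, B x x = 0) (hu : Uni B)
    (hr : 0 < Module.finrank ℤ M) (e : M) : ∃ (c : ℤ) (w z : M), e = c • w ∧ B w z = 1 := by
  obtain ⟨c, hc⟩ := (IsPrincipalIdealRing.principal (LinearMap.range (B e))).principal
  by_cases h0 : c = 0
  · obtain ⟨w, z, h⟩ := exists_hyp hu hr
    refine ⟨0, w, z, ?_, h⟩
    rw [zero_smul]
    apply nondeg ha hu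
    intro w
    have : B e w ∈ LinearMap.range (B e) := ⟨w, rfl⟩
    rw [hc, h0] at this
    simpa using this
  · have hd : ∀ w, ∃ k, B e w = c * k := by
      intro w
      have : B e w ∈ LinearMap.range (B e) := ⟨w, rfl⟩
      rw [hc] at this
      obtain ⟨k, hk⟩ := Submodule.mem_span_singleton.1 this
      exact ⟨k, by rw [← hk, smul_eq_mul, mul_comm]⟩
    choose k hk using hd
    let φ : M →ₗ[ℤ] ℤ :=
      { toFun := k
        map_add' := fun u v => by
          apply mul_left_cancel₀ h0
          rw [← hk, mul_add, ← hk, ← hk, map_add]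
        map_smul' := fun a v => by
          apply mul_left_cancel₀ h0
          rw [← hk, map_smul, hk]; simp; ring }
    obtain ⟨w, hw⟩ := hu φ
    have hcm : c ∈ LinearMap.range (B e) := by
      rw [hc]; exact Submodule.mem_span_singleton_self c
    obtain ⟨z, hz⟩ := hcm
    refine ⟨c, w, z, ?_, ?_⟩
    · rw [← sub_eq_zero]
      apply nondeg ha hu
      intro t
      simp [hw, hk, φ]
    · rw [hw]
      apply mul_left_cancel₀ h0
      change c * k z = c * 1
      rw [← hk, hz, mul_one]

/-- Unimodular alternating lattices of equal rank are isometric. -/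
lemma isometric : ∀ (n : ℕ) (M M' : Type) [AddCommGroup M] [AddCommGroup M']
    [Module.Free ℤ M] [Module.Finite ℤ M] [Module.Free ℤ M'] [Module.Finite ℤ M']
    (B : M →ₗ[ℤ] M →ₗ[ℤ] ℤ) (B' : M' →ₗ[ℤ] M' →ₗ[ℤ] ℤ),
    (∀ x, B x x = 0) → (∀ x, B' x x = 0) → Uni B → Uni B' →
    Module.finrank ℤ M = n → Module.finrank ℤ M' = n →
    ∃ τ : M ≃ₗ[ℤ] M', ∀ u v, B' (τ u) (τ v) = B u v := by
  intro n
  induction n using Nat.strong_induction_on with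
  | _ n ih =>
    intro M M' _ _ _ _ _ _ B B' ha ha' hu hu' hr hr'
    rcases Nat.eq_zero_or_pos n with rfl | hn
    · have : Subsingleton M := Module.finrank_zero_iff.1 hr
      refine ⟨LinearEquiv.ofFinrankEq M M' (hr.trans hr'.symm), fun u v => ?_⟩
      rw [Subsingleton.elim u 0]; simp
    · obtain ⟨e, f, h⟩ := exists_hyp hu (hr ▸ hn)
      obtain ⟨e', f', h'⟩ := exists_hyp hu' (hr' ▸ hn)
      have r1 := finrank_perp ha h
      have r2 := finrank_perp ha' h'
      obtain ⟨σ, hσ⟩ := ih (n - 2) (by omega) (perp B e f) (perp B' e' f')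
        (res B _) (res B' _) (fun x => ha x) (fun x => ha' x) (uni_perp ha hu h)
        (uni_perp ha' hu' h') (by omega) (by omega)
      obtain ⟨τ, hτ, -⟩ := extend ha ha' h h' σ hσ
      exact ⟨τ, hτ⟩

/-- Two orthogonal hyperbolic pairs can be moved to two others. -/
lemma move [Module.Free ℤ M] [Module.Finite ℤ M] (ha : ∀ x, B x x = 0) (hu : Uni B)
    {e f e' f' : M} (h : B e f = 1) (h' : B e' f' = 1)
    {p q : M} (hp : p ∈ perp B e f) (hq : q ∈ perp B e f) (hpq : B p q = 1)
    {p' q' : M} (hp' : p' ∈ perp B e' f') (hq' : q' ∈ perp B e' f') (hpq' : B p' q' = 1) :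
    ∃ τ : M ≃ₗ[ℤ] M, (∀ u v, B (τ u) (τ v) = B u v) ∧ τ e = e' ∧ τ f = f' ∧ τ p = p' := by
  have r1 := finrank_perp ha h
  have r2 := finrank_perp ha h'
  have a1 : ∀ x, res B (perp B e f) x x = 0 := fun x => ha x
  have a2 : ∀ x, res B (perp B e' f') x x = 0 := fun x => ha x
  have u1 := uni_perp ha hu h
  have u2 := uni_perp ha hu h'
  have g1 : res B (perp B e f) ⟨p, hp⟩ ⟨q, hq⟩ = 1 := hpq
  have g2 : res B (perp B e' f') ⟨p', hp'⟩ ⟨q', hq'⟩ = 1 := hpq'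
  have s1 := finrank_perp a1 g1
  have s2 := finrank_perp a2 g2
  obtain ⟨ρ, hρ⟩ := isometric _ _ _ (res (res B (perp B e f)) (perp _ ⟨p, hp⟩ ⟨q, hq⟩))
    (res (res B (perp B e' f')) (perp _ ⟨p', hp'⟩ ⟨q', hq'⟩))
    (fun x => a1 x) (fun x => a2 x) (uni_perp a1 u1 g1) (uni_perp a2 u2 g2)
    rfl (by omega)
  obtain ⟨σ, hσ, k1, -⟩ := extend a1 a2 g1 g2 ρ hρ
  obtain ⟨τ, hτ, k2, k3, k4⟩ := extend ha ha h h' σ hσ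
  refine ⟨τ, hτ, k2, k3, ?_⟩
  have := k4 ⟨p, hp⟩
  rw [k1] at this
  exact this

/-- Normal form of a saturated plane. -/
lemma normal [Module.Free ℤ M] [Module.Finite ℤ M] (ha : ∀ x, B x x = 0) (hu : Uni B)
    (hr : 4 ≤ Module.finrank ℤ M) {d : ℤ} (hd : 0 < d) {x y : M} (hxy : B x y = d)
    (hs : ∀ (n : ℤ) (v : M), n ≠ 0 → n • v ∈ Submodule.span ℤ {x, y} →
      v ∈ Submodule.span ℤ {x, y}) :
    ∃ (f p q : M) (a : ℤ), B x f = 1 ∧ p ∈ perp B x f ∧ q ∈ perp B x f ∧ B p q = 1 ∧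
      y = a • x + d • f + p := by
  -- a vector pairing to one with x
  have hf : ∃ f, B x f = 1 := by
    obtain ⟨c, w, z, hx, hwz⟩ := content ha hu (by omega) x
    have hc : c ≠ 0 := by
      rintro rfl
      rw [hx] at hxy; simp at hxy; omega
    have hw : w ∈ Submodule.span ℤ {x, y} := by
      apply hs c w hc
      rw [← hx]; exact Submodule.subset_span (by simp)
    obtain ⟨α, β, hw⟩ := Submodule.mem_span_pair.1 hw
    have hxw : B x w = 0 := by
      rw [hx]; simp [ha]
    have hβ : β = 0 := by
      rw [← hw] at hxw
      simp [ha, hxy] at hxw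
      omega
    refine ⟨α • z, ?_⟩
    have h1 : B w z = 1 := hwz
    rw [← hw, hβ] at h1
    simpa using h1
  obtain ⟨f, hf⟩ := hf
  have hfx := skew ha f x
  have hr1 := finrank_perp ha hf
  have a1 : ∀ t, res B (perp B x f) t t = 0 := fun t => ha t
  have u1 := uni_perp ha hu hf
  obtain ⟨c, w, z, he, hwz⟩ := content a1 u1 (by omega) (proj ha hf y)
  have he' := congrArg Subtype.val he
  rw [proj_coe, hxy] at he'
  obtain ⟨w, hw⟩ := w
  obtain ⟨z, hz⟩ := z
  change B w z = 1 at hwz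
  change _ = c • w at he'
  have hw' := mem_perp.1 hw
  have hz' := mem_perp.1 hz
  have hcop : IsCoprime c d := by
    rw [Int.isCoprime_iff_gcd_eq_one]
    obtain ⟨c', hc'⟩ := Int.gcd_dvd_left c d
    obtain ⟨d', hd'⟩ := Int.gcd_dvd_right c d
    have hk0 : ((Int.gcd c d : ℕ) : ℤ) ≠ 0 := by
      intro h; rw [h] at hd'; simp at hd'; omega
    generalize hk : ((Int.gcd c d : ℕ) : ℤ) = k at *
    have hm : d' • f + c' • w ∈ Submodule.span ℤ {x, y} := by
      apply hs k _ hk0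
      have : k • (d' • f + c' • w) = (-(B y f)) • x + (1 : ℤ) • y := by
        rw [smul_add, smul_smul, smul_smul, ← hc', ← hd', ← he']
        module
      rw [this]
      exact Submodule.mem_span_pair.2 ⟨_, _, rfl⟩
    obtain ⟨α, β, h⟩ := Submodule.mem_span_pair.1 hm
    have h2 := congrArg (B x) h
    simp [ha, hxy, hf, hw'] at h2
    have hd0 : d' ≠ 0 := by
      rintro rfl; simp at hd'; omega
    have h3 : k * β = 1 := by
      apply mul_left_cancel₀ hd0
      rw [mul_one]
      conv_rhs => rw [← h2, hd']
      ring
    have h4 : IsUnit k := IsUnit.of_mul_eq_one _ h3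
    rw [← hk] at h4
    have := Int.isUnit_iff.1 h4
    omega
  obtain ⟨β, α, hab⟩ := hcop
  have hy : y = B y f • x + d • f + c • w := by
    rw [← he']; module
  have hzw := skew ha z w
  have hwf := skew ha w f
  have hzf := skew ha z f
  have hwx := skew ha w x
  have hzx := skew ha z x
  have hf' : B x (f + z) = 1 := by simp [hf, hz']
  refine ⟨f + z, y - B y (f + z) • x - d • (f + z), α • w + β • z - α • x,
    B y (f + z), hf', ?_, ?_, ?_, by module⟩
  · have := proj_mem ha hf' y
    rwa [hxy] at this
  · rw [mem_perp]
    simp [ha, hw', hz', hzw, hwz, hfx, hf, hzx]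
  · rw [hy]
    generalize B y f = a
    simp [ha, hw', hz', hzw, hwz, hfx, hf, hzx, hwx, hzf, hwf]
    linarith

end SpAux

lemma SpAux.sum_even_odd (g : ℕ) (F : Fin (2 * g) → ℤ) :
    ∑ j, F j = ∑ i : Fin g, (F ⟨2 * i.val, by have := i.isLt; omega⟩ +
      F ⟨2 * i.val + 1, by have := i.isLt; omega⟩) := by
  let f : ℕ → ℤ := fun k => if h : k < 2 * g then F ⟨k, h⟩ else 0
  have h1 : ∀ n, ∑ k ∈ Finset.range (2 * n), f k =
      ∑ i ∈ Finset.range n, (f (2 * i) + f (2 * i + 1)) := by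
    intro n
    induction n with
    | zero => simp
    | succ n ih =>
      rw [show 2 * (n + 1) = 2 * n + 1 + 1 by ring, Finset.sum_range_succ,
        Finset.sum_range_succ, ih, Finset.sum_range_succ]
      ring
  have h2 := h1 g
  rw [Finset.sum_range, Finset.sum_range] at h2
  convert h2 using 2 with j _ i _
  · simp [f]
  · have := i.isLt
    simp only [f]
    rw [dif_pos (by omega), dif_pos (by omega)]

/-- The standard form as a bilinear map. -/
def SpAux.form (g : ℕ) : (Fin (2 * g) → ℤ) →ₗ[ℤ] (Fin (2 * g) → ℤ) →ₗ[ℤ] ℤ :=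
  LinearMap.mk₂ ℤ (stdSymp g)
    (fun a b c => by
      simp only [stdSymp, ← Finset.sum_add_distrib, Pi.add_apply]
      exact Finset.sum_congr rfl fun _ _ => by ring)
    (fun a b c => by
      simp only [stdSymp, Finset.mul_sum, Pi.smul_apply, smul_eq_mul]
      exact Finset.sum_congr rfl fun _ _ => by ring)
    (fun a b c => by
      simp only [stdSymp, ← Finset.sum_add_distrib, Pi.add_apply]
      exact Finset.sum_congr rfl fun _ _ => by ring)
    (fun a b c => by
      simp only [stdSymp, Finset.mul_sum, Pi.smul_apply, smul_eq_mul]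
      exact Finset.sum_congr rfl fun _ _ => by ring)

lemma SpAux.form_apply (g : ℕ) (x y : Fin (2 * g) → ℤ) :
    SpAux.form g x y = stdSymp g x y := rfl

lemma SpAux.form_alt (g : ℕ) (x : Fin (2 * g) → ℤ) : SpAux.form g x x = 0 := by
  rw [SpAux.form_apply, stdSymp]
  exact Finset.sum_eq_zero fun _ _ => by ring

lemma SpAux.form_uni (g : ℕ) : SpAux.Uni (SpAux.form g) := by
  intro φ
  refine ⟨fun j => if h : j.val % 2 = 0 then
      φ (Pi.single ⟨j.val + 1, by have := j.isLt; omega⟩ 1)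
    else - φ (Pi.single ⟨j.val - 1, by have := j.isLt; omega⟩ 1), fun w => ?_⟩
  have hw : φ w = ∑ j, w j * φ (Pi.single j 1) := by
    have h0 : w = ∑ j, w j • (Pi.single j (1 : ℤ) : Fin (2 * g) → ℤ) := by
      ext k
      simp [Finset.sum_apply, Pi.single_apply]
    conv_lhs => rw [h0, map_sum]
    exact Finset.sum_congr rfl fun j _ => by rw [map_smul, smul_eq_mul]
  rw [hw, SpAux.sum_even_odd, SpAux.form_apply, stdSymp]
  refine Finset.sum_congr rfl fun i _ => ?_
  have h1 : ¬ ((2 * i.val + 1) % 2 = 0) := by omega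
  simp only [Nat.mul_mod_right, dite_true, h1, dite_false, Nat.add_sub_cancel]
  ring

end Aux


/-- **Transitivity of `Sp(2g,ℤ)` on complete rank-two symplectic sublattices of
fixed determinant.**  If `U, U' ⊆ ℤ^{2g}` (for `g ≥ 2`) are complete (saturated)
submodules, each spanned by a pair of vectors whose symplectic product is
`d > 0`, then there is an integral symplectic matrix `M` carrying `U` onto `U'`. -/
theorem sp_transitive_on_complete_rank_two_sublattices
    (g : ℕ) (hg : 2 ≤ g) (d : ℤ) (hd : 0 < d)
    (U U' : Submodule ℤ (Fin (2 * g) → ℤ))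
    (hUsat : ∀ (n : ℤ) (v : Fin (2 * g) → ℤ), n ≠ 0 → n • v ∈ U → v ∈ U)
    (hU'sat : ∀ (n : ℤ) (v : Fin (2 * g) → ℤ), n ≠ 0 → n • v ∈ U' → v ∈ U')
    (hU : ∃ x y : Fin (2 * g) → ℤ,
        U = Submodule.span ℤ {x, y} ∧ stdSymp g x y = d)
    (hU' : ∃ x y : Fin (2 * g) → ℤ,
        U' = Submodule.span ℤ {x, y} ∧ stdSymp g x y = d) :
    ∃ M : Matrix (Fin (2 * g)) (Fin (2 * g)) ℤ,
      IsUnit M.det ∧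
      (∀ x y : Fin (2 * g) → ℤ, stdSymp g (M.mulVec x) (M.mulVec y) = stdSymp g x y) ∧
      Submodule.map M.mulVecLin U = U' := by
  obtain ⟨x, y, rfl, hxy⟩ := hU
  obtain ⟨x', y', rfl, hxy'⟩ := hU'
  have ha := SpAux.form_alt g
  have hu := SpAux.form_uni g
  have hr : 4 ≤ Module.finrank ℤ (Fin (2 * g) → ℤ) := by
    simp; omega
  obtain ⟨f, p, q, a, h1, h2, h3, h4, h5⟩ := SpAux.normal ha hu hr hd hxy hUsat
  obtain ⟨f', p', q', a', h1', h2', h3', h4', h5'⟩ := SpAux.normal ha hu hr hd hxy' hU'sat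
  obtain ⟨τ, hτ, t1, t2, t3⟩ := SpAux.move ha hu h1 h1' h2 h3 h4 h2' h3' h4'
  have hmv : ∀ v, (LinearMap.toMatrix' τ.toLinearMap).mulVec v = τ v := by
    intro v
    rw [LinearMap.toMatrix'_mulVec]; rfl
  have hlin : (LinearMap.toMatrix' τ.toLinearMap).mulVecLin = τ.toLinearMap := by
    apply LinearMap.ext
    intro v
    rw [Matrix.mulVecLin_apply, hmv]; rfl
  refine ⟨LinearMap.toMatrix' τ.toLinearMap, ?_, ?_, ?_⟩
  · rw [LinearMap.det_toMatrix']
    exact LinearEquiv.isUnit_det' τ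
  · intro u v
    rw [hmv, hmv]
    exact hτ u v
  · rw [hlin, Submodule.map_span, Set.image_pair]
    have hy : τ y = y' + (a - a') • x' := by
      rw [h5, map_add, map_add, map_smul, map_smul, t1, t2, t3]
      conv_rhs => rw [h5']
      module
    change Submodule.span ℤ {τ x, τ y} = _
    rw [t1, hy]
    apply le_antisymm
    · rw [Submodule.span_le, Set.pair_subset_iff]
      exact ⟨Submodule.mem_span_pair.2 ⟨1, 0, by module⟩,
        Submodule.mem_span_pair.2 ⟨a - a', 1, by module⟩⟩
    · rw [Submodule.span_le, Set.pair_subset_iff]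
      exact ⟨Submodule.mem_span_pair.2 ⟨1, 0, by module⟩,
        Submodule.mem_span_pair.2 ⟨-(a - a'), 1, by module⟩⟩
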